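/- For every even integer k ≥ 4 there exists a threshold n₀ (depending on k) such that for every integer n > n₀ there exists a set P of exactly n points in the plane ℝ² with: (1) no line containing k+1 or more points of P; and (2) more than n^(2 − c/√(log n)) lines containing exactly k points of P, where c = 2·log(3k+6) and log denotes the base-2 logarithm. -/

import Mathlib

open Real

/-- A line in `ℝ^d` (here the plane `ℝ²`), i.e. a set of the form `{a + t • v : t ∈ ℝ}`
with `v ≠ 0`. -/
def IsLine {d : ℕ} (L : Set (EuclideanSpace ℝ (Fin d))) : Prop :=
  ∃ a v : EuclideanSpace ℝ (Fin d), v ≠ 0 ∧ L = {x | ∃ t : ℝ, x = a + t • v}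

lemma line_det {L : Set (EuclideanSpace ℝ (Fin 2))} (hL : IsLine L)
    {x y z : EuclideanSpace ℝ (Fin 2)} (hx : x ∈ L) (hy : y ∈ L) (hz : z ∈ L) :
    (y 0 - x 0) * (z 1 - x 1) = (y 1 - x 1) * (z 0 - x 0) := by
  obtain ⟨a, v, hv, rfl⟩ := hL
  obtain ⟨r, rfl⟩ := hx
  obtain ⟨s, rfl⟩ := hy
  obtain ⟨t, rfl⟩ := hz
  simp
  ring

lemma line_sub {L L' : Set (EuclideanSpace ℝ (Fin 2))} (hL : IsLine L) (hL' : IsLine L')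
    {x y : EuclideanSpace ℝ (Fin 2)} (hxy : x ≠ y) (hx : x ∈ L) (hy : y ∈ L)
    (hx' : x ∈ L') (hy' : y ∈ L') : L ⊆ L' := by
  obtain ⟨a, v, hv, rfl⟩ := hL
  obtain ⟨b, w, hw, rfl⟩ := hL'
  obtain ⟨r, hr⟩ := hx
  obtain ⟨s, hs⟩ := hy
  obtain ⟨r', hr'⟩ := hx'
  obtain ⟨s', hs'⟩ := hy'
  have hrs : s - r ≠ 0 := by
    intro h
    apply hxy
    rw [hr, hs, sub_eq_zero.1 h]
  have e1 : (s - r) • v = (s' - r') • w := by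
    have h1 : (s - r) • v = y - x := by rw [hr, hs]; module
    have h2 : (s' - r') • w = y - x := by rw [hr', hs']; module
    rw [h1, h2]
  have e2 : v = ((s - r)⁻¹ * (s' - r')) • w := by
    rw [mul_smul, ← e1, smul_smul, inv_mul_cancel₀ hrs, one_smul]
  rintro z ⟨t, rfl⟩
  refine ⟨r' + (t - r) * ((s - r)⁻¹ * (s' - r')), ?_⟩
  have e3 : a + t • v = x + (t - r) • v := by rw [hr]; module
  rw [e3, hr', e2]
  module

lemma line_eq {L L' : Set (EuclideanSpace ℝ (Fin 2))} (hL : IsLine L) (hL' : IsLine L')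
    {x y : EuclideanSpace ℝ (Fin 2)} (hxy : x ≠ y) (hx : x ∈ L) (hy : y ∈ L)
    (hx' : x ∈ L') (hy' : y ∈ L') : L = L' :=
  (line_sub hL hL' hxy hx hy hx' hy').antisymm (line_sub hL' hL hxy hx' hy' hx hy)

lemma lines_finite (P : Finset (EuclideanSpace ℝ (Fin 2))) (k : ℕ) (hk : 2 ≤ k) :
    {L : Set (EuclideanSpace ℝ (Fin 2)) | IsLine L ∧ (L ∩ ↑P).ncard = k}.Finite := by
  apply Set.Finite.of_finite_image (f := fun L => L ∩ (P : Set (EuclideanSpace ℝ (Fin 2))))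
  · apply P.finite_toSet.finite_subsets.subset
    rintro _ ⟨L, _, rfl⟩
    exact Set.inter_subset_right
  · rintro L ⟨hL, hLk⟩ L' ⟨hL', -⟩ h
    have h' : L ∩ (P : Set (EuclideanSpace ℝ (Fin 2))) = L' ∩ P := h
    obtain ⟨x, hx, y, hy, hxy⟩ := (Set.one_lt_ncard (P.finite_toSet.inter_of_right L)).1
      (by omega : 1 < (L ∩ (P : Set (EuclideanSpace ℝ (Fin 2)))).ncard)
    have hx' := h' ▸ hx
    have hy' := h' ▸ hy
    exact line_eq hL hL' hxy hx.1 hy.1 hx'.1 hy'.1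

lemma exists_generic (P : Finset (EuclideanSpace ℝ (Fin 2))) :
    ∃ q : EuclideanSpace ℝ (Fin 2), q ∉ P ∧ ∀ L, IsLine L → 2 ≤ (L ∩ ↑P).ncard → q ∉ L := by
  classical
  obtain ⟨x, hx⟩ := Infinite.exists_notMem_finset (P.image (fun a => a 0))
  obtain ⟨y, hy⟩ := Infinite.exists_notMem_finset
    ((P ×ˢ P).image (fun a => a.1 1 + (a.2 1 - a.1 1) * (x - a.1 0) / (a.2 0 - a.1 0)))
  refine ⟨!₂[x, y], ?_, ?_⟩
  · intro h
    apply hx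
    rw [Finset.mem_image]
    exact ⟨_, h, by simp⟩
  · intro L hL h2 hq
    obtain ⟨a, ha, b, hb, hab⟩ := (Set.one_lt_ncard (P.finite_toSet.inter_of_right L)).1
      (by omega : 1 < (L ∩ (P : Set (EuclideanSpace ℝ (Fin 2)))).ncard)
    have hd := line_det hL ha.1 hb.1 hq
    simp at hd
    have hxa : x - a 0 ≠ 0 := by
      intro h
      apply hx
      rw [Finset.mem_image]
      exact ⟨a, ha.2, by linarith⟩
    by_cases h0 : b 0 - a 0 = 0
    · rw [h0, zero_mul, eq_comm, mul_eq_zero] at hd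
      rcases hd with hd | hd
      · apply hab
        ext i
        fin_cases i
        · simp; linarith
        · simp; linarith
      · exact hxa hd
    · apply hy
      rw [Finset.mem_image]
      refine ⟨(a, b), Finset.mem_product.2 ⟨ha.2, hb.2⟩, ?_⟩
      simp only
      rw [← hd]
      field_simp
      ring

lemma padding (P : Finset (EuclideanSpace ℝ (Fin 2))) (r : ℕ) :
    ∃ P' : Finset (EuclideanSpace ℝ (Fin 2)), P'.card = P.card + r ∧
      ∀ L : Set (EuclideanSpace ℝ (Fin 2)), IsLine L →
        (2 ≤ (L ∩ ↑P).ncard → L ∩ ↑P' = L ∩ ↑P) ∧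
        ((L ∩ ↑P).ncard ≤ 1 → (L ∩ ↑P').ncard ≤ 2) := by
  classical
  induction r with
  | zero => exact ⟨P, rfl, fun L _ => ⟨fun _ => rfl, fun h => by omega⟩⟩
  | succ r ih =>
    obtain ⟨Q, hQ, hQL⟩ := ih
    obtain ⟨q, hq, hqL⟩ := exists_generic Q
    refine ⟨insert q Q, by rw [Finset.card_insert_of_notMem hq]; omega, fun L hL => ?_⟩
    obtain ⟨h1, h2⟩ := hQL L hL
    have key : 2 ≤ (L ∩ ↑Q).ncard → L ∩ ↑(insert q Q) = L ∩ (Q : Set (EuclideanSpace ℝ (Fin 2))) := by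
      intro h
      rw [Finset.coe_insert, Set.inter_insert_of_notMem (hqL L hL h)]
    refine ⟨fun h => ?_, fun h => ?_⟩
    · rw [key (by rw [h1 h]; exact h), h1 h]
    · by_cases h3 : 2 ≤ (L ∩ ↑Q).ncard
      · rw [key h3]; exact h2 h
      · have : L ∩ ↑(insert q Q) ⊆ insert q (L ∩ (Q : Set (EuclideanSpace ℝ (Fin 2)))) := by
          rintro z ⟨hz, hz'⟩
          rw [Finset.coe_insert] at hz'
          rcases hz' with rfl | hz'
          · exact Set.mem_insert _ _
          · exact Set.mem_insert_of_mem _ ⟨hz, hz'⟩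
        have h4 := Set.ncard_le_ncard this ((Q.finite_toSet.inter_of_right L).insert q)
        have h5 := Set.ncard_insert_le q (L ∩ (Q : Set (EuclideanSpace ℝ (Fin 2))))
        omega

lemma powers_indep {ι : Type*} [Fintype ι] (t : ℝ) (ht : Transcendental ℤ t) (c : ι → ℤ)
    (e : ι → ℕ) (he : Function.Injective e) (h : ∑ i, (c i : ℝ) * t ^ e i = 0) (i : ι) :
    c i = 0 := by
  classical
  rw [transcendental_iff] at ht
  have hp := ht (∑ i, Polynomial.C (c i) * Polynomial.X ^ e i) (by simpa using h)
  have := congrArg (fun p => Polynomial.coeff p (e i)) hp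
  simpa [Polynomial.finsetSum_coeff, Polynomial.coeff_C_mul, Polynomial.coeff_X_pow, he.eq_iff]
    using this

/-- The projection of an integer vector to the plane. -/
noncomputable def proj (t : ℝ) {D : ℕ} (z : Fin D → ℤ) : EuclideanSpace ℝ (Fin 2) :=
  !₂[∑ i, (z i : ℝ) * t ^ (i : ℕ), ∑ i, (z i : ℝ) * t ^ (D * (i : ℕ))]

lemma proj_add_smul (t : ℝ) {D : ℕ} (z w : Fin D → ℤ) (n : ℤ) :
    proj t (z + n • w) = proj t z + (n : ℝ) • proj t w := by
  ext i
  fin_cases i <;>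
  · simp [proj, Finset.mul_sum, ← Finset.sum_add_distrib]
    refine Finset.sum_congr rfl fun i _ => ?_
    ring

lemma proj_inj (t : ℝ) (ht : Transcendental ℤ t) {D : ℕ} {z w : Fin D → ℤ}
    (h : proj t z = proj t w) : z = w := by
  have h0 := congrArg (fun p => p 0) h
  simp [proj] at h0
  funext i
  have := powers_indep t ht (fun i => z i - w i) (fun i : Fin D => (i : ℕ)) Fin.val_injective
    (by push_cast; simp only [sub_mul, Finset.sum_sub_distrib]; linarith) i
  linarith

lemma proj_det (t : ℝ) (ht : Transcendental ℤ t) {D : ℕ} (x y z : Fin D → ℤ)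
    (h : (proj t y 0 - proj t x 0) * (proj t z 1 - proj t x 1) =
      (proj t y 1 - proj t x 1) * (proj t z 0 - proj t x 0)) (i j : Fin D) :
    (y i - x i) * (z j - x j) = (y j - x j) * (z i - x i) := by
  have := powers_indep t ht
    (fun p : Fin D × Fin D => (y p.2 - x p.2) * (z p.1 - x p.1) - (y p.1 - x p.1) * (z p.2 - x p.2))
    (fun p => ((finProdFinEquiv p : Fin (D * D)) : ℕ))
    (Fin.val_injective.comp finProdFinEquiv.injective) ?_ (j, i)
  · simp only at this
    linarith
  · simp only [proj] at h
    simp [← Finset.sum_sub_distrib, ← sub_mul] at h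
    rw [← sub_eq_zero, Finset.sum_mul_sum, Finset.sum_mul_sum, Finset.sum_comm,
      ← Finset.sum_sub_distrib] at h
    simp only [← Finset.sum_sub_distrib] at h
    rw [Fintype.sum_prod_type, ← h]
    refine Finset.sum_congr rfl fun a _ => Finset.sum_congr rfl fun b _ => ?_
    simp [finProdFinEquiv, pow_add]
    ring

/-- The lifted point. -/
def lft {d : ℕ} (x : Fin d → ℤ) (e : ℤ) : Fin (d + 1) → ℤ := Fin.cons (∑ i, x i ^ 2 + e) x

lemma lft_strict {d : ℕ} (x y z : Fin d → ℤ) (e : ℤ) (hxy : y ≠ x) (hxz : z ≠ x)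
    (h : ∀ i j, (lft y e i - lft x e i) * (lft z e j - lft x e j) =
      (lft y e j - lft x e j) * (lft z e i - lft x e i)) : y = z := by
  obtain ⟨u, rfl⟩ : ∃ u, y = x + u := ⟨y - x, by simp⟩
  obtain ⟨v, rfl⟩ : ∃ v, z = x + v := ⟨z - x, by simp⟩
  have h1 : ∀ i j, u i * v j = u j * v i := by
    intro i j
    have := h i.succ j.succ
    simpa [lft] using this
  have h2 : ∀ i, (2 * ∑ j, x j * u j + ∑ j, u j ^ 2) * v i =
      u i * (2 * ∑ j, x j * v j + ∑ j, v j ^ 2) := by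
    intro i
    have := h 0 i.succ
    simp [lft, ← Finset.sum_sub_distrib] at this
    convert this using 2 <;>
    · rw [Finset.mul_sum, ← Finset.sum_add_distrib]
      refine Finset.sum_congr rfl fun j _ => ?_
      ring
  have h3 : ∀ i, (∑ j, x j * u j) * v i = u i * ∑ j, x j * v j := by
    intro i
    rw [Finset.sum_mul, Finset.mul_sum]
    refine Finset.sum_congr rfl fun j _ => ?_
    linear_combination x j * h1 j i
  have h4 : ∀ i, (∑ j, u j ^ 2) * v i = u i * ∑ j, u j * v j := by
    intro i
    rw [Finset.sum_mul, Finset.mul_sum]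
    refine Finset.sum_congr rfl fun j _ => ?_
    linear_combination u j * h1 j i
  have h5 : ∀ i, (∑ j, u j * v j) * v i = u i * ∑ j, v j ^ 2 := by
    intro i
    rw [Finset.sum_mul, Finset.mul_sum]
    refine Finset.sum_congr rfl fun j _ => ?_
    linear_combination v j * h1 j i
  have h6 : ∀ i, u i * (∑ j, u j * v j - ∑ j, v j ^ 2) = 0 := by
    intro i
    linear_combination h2 i - 2 * h3 i - h4 i
  have h7 : ∀ i, v i * (∑ j, u j * v j - ∑ j, u j ^ 2) = 0 := by
    intro i
    linear_combination - h2 i + 2 * h3 i + h5 i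
  obtain ⟨i, hi⟩ : ∃ i, u i ≠ 0 := by
    by_contra! hc
    exact hxy (by funext i; simp [hc i])
  obtain ⟨j, hj⟩ : ∃ i, v i ≠ 0 := by
    by_contra! hc
    exact hxz (by funext i; simp [hc i])
  have h8 := (mul_eq_zero.1 (h6 i)).resolve_left hi
  have h9 := (mul_eq_zero.1 (h7 j)).resolve_left hj
  have h10 : ∑ j, (u j - v j) ^ 2 = 0 := by
    have : ∑ j, (u j - v j) ^ 2 = ∑ j, u j ^ 2 - 2 * ∑ j, u j * v j + ∑ j, v j ^ 2 := by
      rw [Finset.mul_sum, ← Finset.sum_sub_distrib, ← Finset.sum_add_distrib]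
      refine Finset.sum_congr rfl fun j _ => ?_
      ring
    rw [this]; linarith
  rw [Finset.sum_eq_zero_iff_of_nonneg (fun j _ => sq_nonneg _)] at h10
  funext j
  have := pow_eq_zero_iff (two_ne_zero) |>.1 (h10 j (Finset.mem_univ _))
  simp; linarith

lemma lft_line {d : ℕ} (p v : Fin d → ℤ) (s K i : ℤ) (hs : ∑ j, v j ^ 2 = s) :
    lft p 0 + i • (Fin.cons (2 * ∑ j, p j * v j + K * s) v : Fin (d + 1) → ℤ) =
      lft (p + i • v) (i * (K - i) * s) := by
  funext j
  refine Fin.cases ?_ (fun j => ?_) j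
  · simp [lft]
    have : ∑ j, (p j + i * v j) ^ 2 = ∑ j, p j ^ 2 + 2 * i * ∑ j, p j * v j + i ^ 2 * ∑ j, v j ^ 2 := by
      rw [Finset.mul_sum, Finset.mul_sum, ← Finset.sum_add_distrib, ← Finset.sum_add_distrib]
      refine Finset.sum_congr rfl fun j _ => ?_
      ring
    rw [this, hs]; ring
  · simp [lft]

lemma pigeon (d m : ℕ) (hd : 1 ≤ d) (hm : 1 ≤ m) :
    ∃ s : ℤ, m ^ d ≤ (d * m ^ 2) * ((Fintype.piFinset
      (fun _ : Fin d => Finset.Icc (1 : ℤ) m)).filter (fun v => ∑ j, v j ^ 2 = s)).card := by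
  have hpos : (0 : ℝ) < d * m ^ 2 := by positivity
  have H : ∃ s ∈ Finset.Icc (1 : ℤ) (d * m ^ 2), (m : ℝ) ^ d / (d * m ^ 2) ≤ ((Fintype.piFinset
      (fun _ : Fin d => Finset.Icc (1 : ℤ) m)).filter (fun v => ∑ j, v j ^ 2 = s)).card := by
    refine Finset.exists_le_card_fiber_of_nsmul_le_card_of_maps_to ?_ ?_ ?_
    · intro v hv
      rw [Fintype.mem_piFinset] at hv
      simp only [Finset.mem_Icc] at hv ⊢
      constructor
      · have : ∑ j : Fin d, (1 : ℤ) ≤ ∑ j, v j ^ 2 :=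
          Finset.sum_le_sum fun j _ => by nlinarith [hv j]
        simp at this
        have : (1 : ℤ) ≤ d := by exact_mod_cast hd
        linarith
      · have : ∑ j, v j ^ 2 ≤ ∑ j : Fin d, (m : ℤ) ^ 2 :=
          Finset.sum_le_sum fun j _ => by nlinarith [hv j]
        simpa using this
    · rw [Finset.nonempty_Icc]
      have : 1 ≤ d * m ^ 2 := Nat.one_le_iff_ne_zero.2 (by positivity)
      exact_mod_cast this
    · have h1 : (Finset.Icc (1 : ℤ) (d * m ^ 2)).card = d * m ^ 2 := by
        rw [Int.card_Icc]
        have : ((d : ℤ) * m ^ 2 + 1 - 1) = ((d * m ^ 2 : ℕ) : ℤ) := by push_cast; ring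
        rw [this, Int.toNat_natCast]
      rw [h1, nsmul_eq_mul, Fintype.card_piFinset_const]
      simp
      field_simp
      exact le_rfl
  obtain ⟨s, -, hs⟩ := H
  refine ⟨s, ?_⟩
  rw [div_le_iff₀ hpos] at hs
  have : (m : ℝ) ^ d ≤ (d * m ^ 2) * ((Fintype.piFinset
    (fun _ : Fin d => Finset.Icc (1 : ℤ) m)).filter (fun v => ∑ j, v j ^ 2 = s)).card := by
    linarith
  exact_mod_cast this

lemma ncard_inter_eq (P : Finset (EuclideanSpace ℝ (Fin 2))) (L : Set (EuclideanSpace ℝ (Fin 2)))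
    [DecidablePred (· ∈ L)] :
    (L ∩ (P : Set (EuclideanSpace ℝ (Fin 2)))).ncard = (P.filter (· ∈ L)).card := by
  rw [← Set.ncard_coe_finset]
  congr 1
  ext x
  simp [and_comm]

lemma construction (k d m : ℕ) (hk : 4 ≤ k) (hke : Even k) (hd : 1 ≤ d) (hm : 1 ≤ m) :
    ∃ P : Finset (EuclideanSpace ℝ (Fin 2)), P.card ≤ (k / 2) * (k * m) ^ d ∧
      (∀ L : Set (EuclideanSpace ℝ (Fin 2)), IsLine L → (L ∩ ↑P).ncard ≤ k) ∧
      m ^ d * m ^ d ≤ (k ^ 2 * (d * m ^ 2)) *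
        Set.ncard {L : Set (EuclideanSpace ℝ (Fin 2)) | IsLine L ∧ (L ∩ ↑P).ncard = k} := by
  classical
  obtain ⟨t, ht⟩ : ∃ t : ℝ, Transcendental ℤ t := ⟨_, transcendental_liouvilleNumber le_rfl⟩
  obtain ⟨s, hs⟩ := pigeon d m hd hm
  set V := (Fintype.piFinset
      (fun _ : Fin d => Finset.Icc (1 : ℤ) m)).filter (fun v => ∑ j, v j ^ 2 = s) with hV
  set B := Fintype.piFinset (fun _ : Fin d => Finset.Ico (0 : ℤ) (k * m)) with hB
  set A := Fintype.piFinset (fun _ : Fin d => Finset.Ico (0 : ℤ) m) with hA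
  have hBc : B.card = (k * m) ^ d := by
    rw [hB, Fintype.card_piFinset_const, Int.card_Ico]
    have : ((k : ℤ) * m - 0) = ((k * m : ℕ) : ℤ) := by push_cast; ring
    rw [this, Int.toNat_natCast]
  have hAc : A.card = m ^ d := by
    rw [hA, Fintype.card_piFinset_const, Int.card_Ico]
    simp
  let Q : ℕ → Finset (EuclideanSpace ℝ (Fin 2)) := fun i =>
    B.image (fun x => proj t (lft x (i * ((k : ℤ) - 1 - i) * s)))
  let P := (Finset.range (k / 2)).biUnion Q
  have hPk : ∀ L : Set (EuclideanSpace ℝ (Fin 2)), IsLine L → (L ∩ ↑P).ncard ≤ k := by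
    intro L hL
    rw [ncard_inter_eq, Finset.filter_biUnion]
    refine (Finset.card_biUnion_le_card_mul _ _ 2 fun i _ => ?_).trans ?_
    · by_contra! hc
      obtain ⟨a, ha, b, hb, c, hc, hab, hac, hbc⟩ := Finset.two_lt_card.1 hc
      rw [Finset.mem_filter, Finset.mem_image] at ha hb hc
      obtain ⟨⟨x, -, rfl⟩, ha⟩ := ha
      obtain ⟨⟨y, -, rfl⟩, hb⟩ := hb
      obtain ⟨⟨z, -, rfl⟩, hc⟩ := hc
      have := lft_strict x y z _ (fun h => hab (by rw [h])) (fun h => hac (by rw [h]))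
        (proj_det t ht _ _ _ (line_det hL ha hb hc))
      exact hbc (by rw [this])
    · rw [Finset.card_range]; omega
  refine ⟨P, ?_, hPk, ?_⟩
  · refine (Finset.card_biUnion_le_card_mul _ _ ((k * m) ^ d) fun i _ => ?_).trans ?_
    · exact Finset.card_image_le.trans hBc.le
    · rw [Finset.card_range]
  · let W : (Fin d → ℤ) → (Fin d → ℤ) → (Fin (d + 1) → ℤ) := fun p v =>
      Fin.cons (2 * ∑ j, p j * v j + ((k : ℤ) - 1) * s) v
    let ℓ : (Fin d → ℤ) × (Fin d → ℤ) → Set (EuclideanSpace ℝ (Fin 2)) := fun q =>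
      {x | ∃ r : ℝ, x = proj t (lft q.1 0) + r • proj t (W q.1 q.2)}
    -- membership facts
    have hmemP : ∀ p ∈ A, ∀ v ∈ V, ∀ i < k, proj t (lft p 0 + (i : ℤ) • W p v) ∈ P := by
      intro p hp v hv i hi
      rw [hV, Finset.mem_filter, Fintype.mem_piFinset] at hv
      rw [hA, Fintype.mem_piFinset] at hp
      simp only [Finset.mem_Icc, Finset.mem_Ico] at hv hp
      rw [lft_line p v s _ i hv.2]
      have hin : p + (i : ℤ) • v ∈ B := by
        rw [hB, Fintype.mem_piFinset]
        intro j
        have h1 := hp j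
        have h2 := hv.1 j
        have hi' : (i : ℤ) + 1 ≤ k := by exact_mod_cast hi
        simp only [Pi.add_apply, Pi.smul_apply, smul_eq_mul, Finset.mem_Ico]
        constructor
        · have : 0 ≤ (i : ℤ) * v j := mul_nonneg (by positivity) (by linarith)
          linarith
        · have h3 : (i : ℤ) * v j ≤ i * m := mul_le_mul_of_nonneg_left h2.2 (by positivity)
          have h4 : ((i : ℤ) + 1) * m ≤ k * m := mul_le_mul_of_nonneg_right hi' (by positivity)
          linarith
      rw [Finset.mem_biUnion]
      obtain ⟨h, hh⟩ := hke
      by_cases hc : i < k / 2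
      · exact ⟨i, Finset.mem_range.2 hc, Finset.mem_image.2 ⟨_, hin, rfl⟩⟩
      · refine ⟨k - 1 - i, Finset.mem_range.2 (by omega), Finset.mem_image.2 ⟨_, hin, ?_⟩⟩
        have : ((k - 1 - i : ℕ) : ℤ) = (k : ℤ) - 1 - i := by omega
        rw [this]
        congr 2
        ring
    have hWne : ∀ p, ∀ v ∈ V, proj t (W p v) ≠ 0 := by
      intro p v hv h0
      rw [hV, Finset.mem_filter, Fintype.mem_piFinset] at hv
      have h1 : proj t (W p v) = proj t (0 : Fin (d + 1) → ℤ) := by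
        rw [h0]
        ext i
        fin_cases i <;> simp [proj]
      have h2 := congrFun (proj_inj t ht h1) (Fin.succ ⟨0, hd⟩)
      have h3 := hv.1 ⟨0, hd⟩
      rw [Finset.mem_Icc] at h3
      simp only [W, Fin.cons_succ, Pi.zero_apply] at h2
      omega
    have hmemL : ∀ p v, ∀ i : ℕ, proj t (lft p 0 + (i : ℤ) • W p v) ∈ ℓ (p, v) := by
      intro p v i
      exact ⟨i, by rw [proj_add_smul]; simp⟩
    have hline : ∀ q ∈ A ×ˢ V, IsLine (ℓ q) ∧ (ℓ q ∩ ↑P).ncard = k := by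
      rintro ⟨p, v⟩ hq
      rw [Finset.mem_product] at hq
      have hL : IsLine (ℓ (p, v)) := ⟨_, _, hWne p v hq.2, rfl⟩
      refine ⟨hL, le_antisymm (hPk _ hL) ?_⟩
      have hsub : (((Finset.range k).image (fun i : ℕ => proj t (lft p 0 + (i : ℤ) • W p v)) :
          Finset (EuclideanSpace ℝ (Fin 2))) : Set (EuclideanSpace ℝ (Fin 2))) ⊆ ℓ (p, v) ∩ ↑P := by
        intro z hz
        rw [Finset.mem_coe, Finset.mem_image] at hz
        obtain ⟨i, hi, rfl⟩ := hz
        exact ⟨hmemL p v i, hmemP p hq.1 v hq.2 i (Finset.mem_range.1 hi)⟩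
      have := Set.ncard_le_ncard hsub (P.finite_toSet.inter_of_right _)
      rw [Set.ncard_coe_finset, Finset.card_image_of_injective, Finset.card_range] at this
      · exact this
      · intro i j hij
        simp only [proj_add_smul] at hij
        have := smul_left_injective ℝ (hWne p v hq.2) (add_left_cancel hij)
        exact_mod_cast this
    have himg : ((A ×ˢ V).image ℓ).card ≤
        Set.ncard {L : Set (EuclideanSpace ℝ (Fin 2)) | IsLine L ∧ (L ∩ ↑P).ncard = k} := by
      rw [← Set.ncard_coe_finset]
      refine Set.ncard_le_ncard ?_ (lines_finite P k (by omega))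
      intro L hL
      rw [Finset.mem_coe, Finset.mem_image] at hL
      obtain ⟨q, hq, rfl⟩ := hL
      exact hline q hq
    have hfib : (A ×ˢ V).card ≤ k ^ 2 * ((A ×ˢ V).image ℓ).card := by
      refine Finset.card_le_mul_card_image _ _ fun L hL => ?_
      obtain ⟨q, hq, rfl⟩ := Finset.mem_image.1 hL
      have hk2 : ((P.filter (· ∈ ℓ q)) ×ˢ (P.filter (· ∈ ℓ q))).card = k ^ 2 := by
        rw [Finset.card_product, ← ncard_inter_eq, (hline q hq).2, sq]
      rw [← hk2]
      refine Finset.card_le_card_of_injOn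
        (fun q => (proj t (lft q.1 0 + ((0 : ℕ) : ℤ) • W q.1 q.2),
          proj t (lft q.1 0 + ((1 : ℕ) : ℤ) • W q.1 q.2))) ?_ ?_
      · rintro ⟨p, v⟩ hpv
        rw [Finset.mem_coe, Finset.mem_filter, Finset.mem_product] at hpv
        rw [Finset.mem_coe, Finset.mem_product, Finset.mem_filter, Finset.mem_filter, ← hpv.2]
        exact ⟨⟨hmemP p hpv.1.1 v hpv.1.2 0 (by omega), hmemL p v 0⟩,
          ⟨hmemP p hpv.1.1 v hpv.1.2 1 (by omega), hmemL p v 1⟩⟩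
      · rintro ⟨p, v⟩ - ⟨p', v'⟩ - h
        simp only [Prod.mk.injEq] at h
        have h1 := proj_inj t ht h.1
        have h2 := proj_inj t ht h.2
        have hp : p = p' := by
          funext j
          simpa [lft] using congrFun h1 j.succ
        subst hp
        have hv : v = v' := by
          funext j
          simpa [lft, W] using congrFun h2 j.succ
        rw [hv]
    rw [Finset.card_product, hAc] at hfib
    calc m ^ d * m ^ d ≤ m ^ d * ((d * m ^ 2) * V.card) := Nat.mul_le_mul_left _ hs
      _ = (d * m ^ 2) * (m ^ d * V.card) := by ring
      _ ≤ (d * m ^ 2) * (k ^ 2 * ((A ×ˢ V).image ℓ).card) := Nat.mul_le_mul_left _ hfib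
      _ = (k ^ 2 * (d * m ^ 2)) * ((A ×ˢ V).image ℓ).card := by ring
      _ ≤ _ := Nat.mul_le_mul_left _ himg

lemma numeric (k n d : ℕ) (hk : 4 ≤ k) (E : ℝ) (hn : (n : ℝ) = 2 ^ (E ^ 2)) (hd : 1 ≤ d)
    (hdE : (d : ℝ) ≤ E) (hEd : E ≤ d + 1)
    (c1 : ((k : ℝ) / 2) * (k / (k + 1)) ^ d ≤ 1)
    (c2 : ((k : ℝ) + 1) * (k + 2) ≤ 2 ^ d)
    (c3 : 16 * (k : ℝ) ^ 2 * E < (9 / 4) ^ E) :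
    ∃ m : ℕ, 1 ≤ m ∧ (k / 2) * (k * m) ^ d ≤ n ∧
      ((k : ℝ) ^ 2 * (d * m ^ 2)) *
        (n : ℝ) ^ ((2 : ℝ) - (2 * Real.logb 2 (3 * (k : ℝ) + 6)) / E) < (m : ℝ) ^ d * m ^ d := by
  have hd' : (1 : ℝ) ≤ d := by exact_mod_cast hd
  have hk' : (4 : ℝ) ≤ k := by exact_mod_cast hk
  have hE : 1 ≤ E := hd'.trans hdE
  have hE0 : 0 < E := by linarith
  have hn0 : (0 : ℝ) < n := by rw [hn]; positivity
  obtain ⟨y, hy⟩ : ∃ y : ℝ, y = 2 ^ (E ^ 2 / d) := ⟨_, rfl⟩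
  have hy0 : 0 < y := by rw [hy]; positivity
  have hyd : y ^ d = n := by
    rw [hy, hn, ← Real.rpow_natCast, ← Real.rpow_mul (by norm_num)]
    congr 1
    field_simp
  have hylow : (2 : ℝ) ^ d ≤ y := by
    rw [hy, ← Real.rpow_natCast]
    apply Real.rpow_le_rpow_of_exponent_le (by norm_num)
    rw [le_div_iff₀ (by linarith)]
    nlinarith
  have hyup : y ≤ 4 * 2 ^ E := by
    have : (4 : ℝ) * 2 ^ E = 2 ^ (E + 2) := by
      rw [Real.rpow_add (by norm_num)]; norm_num; ring
    rw [this, hy]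
    apply Real.rpow_le_rpow_of_exponent_le (by norm_num)
    rw [div_le_iff₀ (by linarith)]
    nlinarith
  obtain ⟨m, hm⟩ : ∃ m : ℕ, m = ⌊y / (k + 1)⌋₊ := ⟨_, rfl⟩
  have hmup : (m : ℝ) ≤ y / (k + 1) := by rw [hm]; exact Nat.floor_le (by positivity)
  have hmlow : y / (k + 2) ≤ m := by
    have h1 : y / (k + 1) < m + 1 := by rw [hm]; exact Nat.lt_floor_add_one _
    have h2 : y / (k + 2) + 1 ≤ y / (k + 1) := by
      rw [div_add_one (by positivity), div_le_div_iff₀ (by positivity) (by positivity)]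
      nlinarith [c2.trans hylow]
    linarith
  have hm1 : 1 ≤ m := by
    have : (0 : ℝ) < m := lt_of_lt_of_le (by positivity) hmlow
    exact_mod_cast this
  have hmy : (m : ℝ) ≤ y := hmup.trans (div_le_self hy0.le (by linarith))
  refine ⟨m, hm1, ?_, ?_⟩
  · have h1 : ((k / 2 : ℕ) : ℝ) ≤ (k : ℝ) / 2 := Nat.cast_div_le
    have h2 : ((k : ℝ) * m) ^ d ≤ (k / (k + 1)) ^ d * n := by
      rw [← hyd, ← mul_pow]
      apply pow_le_pow_left₀ (by positivity)
      calc (k : ℝ) * m ≤ k * (y / (k + 1)) := by gcongr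
        _ = _ := by ring
    have : ((k / 2 : ℕ) : ℝ) * ((k : ℝ) * m) ^ d ≤ n := by
      calc ((k / 2 : ℕ) : ℝ) * ((k : ℝ) * m) ^ d ≤ ((k : ℝ) / 2) * ((k / (k + 1)) ^ d * n) := by
            gcongr
        _ = (((k : ℝ) / 2) * (k / (k + 1)) ^ d) * n := by ring
        _ ≤ 1 * n := by gcongr
        _ = n := one_mul _
    exact_mod_cast this
  · have hexp : (n : ℝ) ^ ((2 : ℝ) - (2 * Real.logb 2 (3 * (k : ℝ) + 6)) / E) =
        (n : ℝ) ^ 2 / (3 * (k : ℝ) + 6) ^ (2 * E) := by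
      rw [Real.rpow_sub hn0]
      congr 1
      · norm_num
      · conv_rhs => rw [← Real.rpow_logb (b := 2) (x := 3 * (k : ℝ) + 6) (by norm_num) (by norm_num)
          (by positivity)]
        rw [hn, ← Real.rpow_mul (by norm_num), ← Real.rpow_mul (by norm_num)]
        congr 1
        field_simp
    have hmd : (n : ℝ) ≤ (k + 2) ^ d * (m : ℝ) ^ d := by
      rw [← hyd, ← mul_pow]
      apply pow_le_pow_left₀ hy0.le
      rw [div_le_iff₀ (by positivity)] at hmlow
      linarith
    have hkd : ((k : ℝ) + 2) ^ d ≤ (k + 2) ^ E := by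
      rw [← Real.rpow_natCast]
      exact Real.rpow_le_rpow_of_exponent_le (by linarith) hdE
    have h3 : (3 * (k : ℝ) + 6) ^ (2 * E) = 9 ^ E * ((k + 2) ^ E) ^ 2 := by
      have : (3 * (k : ℝ) + 6) = 3 * (k + 2) := by ring
      have h4 : (((k : ℝ) + 2) ^ E) ^ 2 = ((k + 2) ^ 2) ^ E := by
        rw [← Real.rpow_natCast, ← Real.rpow_mul (by positivity), mul_comm E,
          Real.rpow_mul (by positivity), Real.rpow_natCast]
      rw [this, h4, ← Real.mul_rpow (by norm_num) (by positivity), Real.rpow_mul (by positivity)]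
      congr 1
      norm_num
      ring
    have h9 : (9 : ℝ) ^ E = (9 / 4) ^ E * (2 ^ E) ^ 2 := by
      rw [← Real.rpow_natCast, ← Real.rpow_mul (by positivity),
        mul_comm E, Real.rpow_mul (by positivity), ← Real.mul_rpow (by norm_num) (by positivity)]
      norm_num
    rw [hexp, h3, h9, mul_div_assoc', div_lt_iff₀ (by positivity)]
    have hX : (0 : ℝ) < (m : ℝ) ^ d := by positivity
    calc (k : ℝ) ^ 2 * (d * m ^ 2) * n ^ 2
        ≤ (k : ℝ) ^ 2 * (E * (4 * 2 ^ E) ^ 2) * ((k + 2) ^ E * (m : ℝ) ^ d) ^ 2 := by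
          have := hmy.trans hyup
          have h5 : (n : ℝ) ≤ (k + 2) ^ E * (m : ℝ) ^ d := hmd.trans (by gcongr)
          gcongr
      _ = (16 * (k : ℝ) ^ 2 * E) * ((2 ^ E) ^ 2 * (((k + 2) ^ E) ^ 2 * ((m : ℝ) ^ d * m ^ d))) := by
          ring
      _ < (9 / 4) ^ E * ((2 ^ E) ^ 2 * (((k + 2) ^ E) ^ 2 * ((m : ℝ) ^ d * m ^ d))) := by
          gcongr
      _ = _ := by ring

lemma eventually_conds (k : ℕ) (hk : 4 ≤ k) : ∀ᶠ n : ℕ in Filter.atTop, ∃ (d : ℕ) (E : ℝ),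
    E = Real.sqrt (Real.logb 2 (n : ℝ)) ∧ (n : ℝ) = 2 ^ (E ^ 2) ∧ 1 ≤ d ∧
    (d : ℝ) ≤ E ∧ E ≤ d + 1 ∧
    ((k : ℝ) / 2) * (k / (k + 1)) ^ d ≤ 1 ∧
    ((k : ℝ) + 1) * (k + 2) ≤ 2 ^ d ∧
    16 * (k : ℝ) ^ 2 * E < (9 / 4) ^ E := by
  have hk' : (4 : ℝ) ≤ k := by exact_mod_cast hk
  have hT : Filter.Tendsto (fun n : ℕ => Real.sqrt (Real.logb 2 (n : ℝ))) Filter.atTop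
      Filter.atTop :=
    Real.tendsto_sqrt_atTop.comp
      ((Real.tendsto_logb_atTop (by norm_num)).comp tendsto_natCast_atTop_atTop)
  have hF : Filter.Tendsto (fun n : ℕ => ⌊Real.sqrt (Real.logb 2 (n : ℝ))⌋₊) Filter.atTop
      Filter.atTop := tendsto_nat_floor_atTop.comp hT
  have e1 : ∀ᶠ d : ℕ in Filter.atTop, ((k : ℝ) / 2) * (k / (k + 1)) ^ d ≤ 1 := by
    have h := (tendsto_pow_atTop_nhds_zero_of_lt_one (r := (k : ℝ) / (k + 1)) (by positivity)
      (by rw [div_lt_one (by positivity)]; linarith)).const_mul ((k : ℝ) / 2)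
    rw [mul_zero] at h
    exact h.eventually_le_const (by norm_num)
  have e2 : ∀ᶠ d : ℕ in Filter.atTop, ((k : ℝ) + 1) * (k + 2) ≤ 2 ^ d :=
    (tendsto_pow_atTop_atTop_of_one_lt (by norm_num : (1 : ℝ) < 2)).eventually_ge_atTop _
  have e3 : ∀ᶠ E : ℝ in Filter.atTop, 16 * (k : ℝ) ^ 2 * E < (9 / 4) ^ E := by
    have hlog : 0 < Real.log (9 / 4) := Real.log_pos (by norm_num)
    have h := isLittleO_pow_exp_pos_mul_atTop 1 hlog
    have h2 := h.def (c := 1 / (32 * (k : ℝ) ^ 2)) (by positivity)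
    filter_upwards [h2, Filter.eventually_gt_atTop 0] with E hE hE0
    rw [Real.rpow_def_of_pos (by norm_num)]
    simp only [pow_one, Real.norm_eq_abs, Real.abs_exp, abs_of_pos hE0] at hE
    have hp := Real.exp_pos (Real.log (9 / 4) * E)
    rw [one_div, inv_mul_eq_div, le_div_iff₀ (by positivity)] at hE
    nlinarith
  filter_upwards [hF.eventually e1, hF.eventually e2, hT.eventually e3, hF.eventually_ge_atTop 1,
    Filter.eventually_ge_atTop 1] with n h1 h2 h3 h4 h5
  have hn1 : (1 : ℝ) ≤ n := by exact_mod_cast h5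
  refine ⟨_, _, rfl, ?_, h4, Nat.floor_le (Real.sqrt_nonneg _), (Nat.lt_floor_add_one _).le,
    h1, h2, h3⟩
  rw [Real.sq_sqrt (Real.logb_nonneg (by norm_num) hn1),
    Real.rpow_logb (by norm_num) (by norm_num) (by linarith)]

/-- For every even integer `k ≥ 4` there is a threshold `n₀` such that for all `n > n₀` there
is an `n`-point planar set `P` with no `k+1` collinear points and more than
`n ^ (2 - c / √(log n))` lines containing exactly `k` points of `P`, where
`c = 2 * log (3k + 6)` (base-2 logarithm). -/
theorem many_k_point_lines_no_k_plus_one_even (k : ℕ) (hk : 4 ≤ k) (hke : Even k) :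
    ∃ n₀ : ℕ, ∀ n : ℕ, n > n₀ →
      ∃ P : Finset (EuclideanSpace ℝ (Fin 2)),
        P.card = n ∧
        (∀ L : Set (EuclideanSpace ℝ (Fin 2)), IsLine L → (L ∩ ↑P).ncard ≤ k) ∧
        ((Set.ncard {L : Set (EuclideanSpace ℝ (Fin 2)) |
            IsLine L ∧ (L ∩ ↑P).ncard = k} : ℝ) >
          (n : ℝ) ^ ((2 : ℝ) - (2 * Real.logb 2 (3 * (k : ℝ) + 6)) /
            Real.sqrt (Real.logb 2 (n : ℝ)))) := by
  obtain ⟨n₀, hn₀⟩ := Filter.eventually_atTop.1 (eventually_conds k hk)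
  refine ⟨n₀, fun n hn => ?_⟩
  obtain ⟨d, E, hE, h1, h2, h3, h4, h5, h6, h7⟩ := hn₀ n hn.le
  rw [← hE]
  obtain ⟨m, hm1, hm2, hm3⟩ := numeric k n d hk E h1 h2 h3 h4 h5 h6 h7
  obtain ⟨P, hP1, hP2, hP3⟩ := construction k d m hk hke h2 hm1
  obtain ⟨P', hP'1, hP'2⟩ := padding P (n - P.card)
  refine ⟨P', by omega, ?_, ?_⟩
  · intro L hL
    obtain ⟨a, b⟩ := hP'2 L hL
    by_cases hc : 2 ≤ (L ∩ (P : Set (EuclideanSpace ℝ (Fin 2)))).ncard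
    · rw [a hc]; exact hP2 L hL
    · exact (b (by omega)).trans (by omega)
  · have hsub : {L : Set (EuclideanSpace ℝ (Fin 2)) | IsLine L ∧ (L ∩ ↑P).ncard = k} ⊆
        {L : Set (EuclideanSpace ℝ (Fin 2)) | IsLine L ∧ (L ∩ ↑P').ncard = k} := by
      rintro L ⟨hL, hLk⟩
      exact ⟨hL, by rw [(hP'2 L hL).1 (by omega), hLk]⟩
    have hle := Set.ncard_le_ncard hsub (lines_finite P' k (by omega))
    have hP3' := hP3.trans (Nat.mul_le_mul_left _ hle)
    have hP4 : (m : ℝ) ^ d * m ^ d ≤ ((k : ℝ) ^ 2 * (d * m ^ 2)) * (Set.ncard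
        {L : Set (EuclideanSpace ℝ (Fin 2)) | IsLine L ∧ (L ∩ ↑P').ncard = k} : ℝ) := by
      exact_mod_cast hP3'
    have := hm3.trans_le hP4
    exact lt_of_mul_lt_mul_left this (by positivity)
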